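/- arXiv:0804.2763 — 2 statements merged into one kernel-verified Lean document; each statement's English description precedes it below -/
import Mathlib

section
/- Let p be an odd prime, G a finite group, V a faithful finite-dimensional F_p[G]-module, and E ≤ G a nonidentity elementary abelian p-subgroup with |E|·|C_V(E)| ≥ |V| (i.e., E is an offender). Then E contains a quadratic element: some g ∈ E, g ≠ 1, with (g−1)^2 V = 0. -/
open Module

/-- The fixed-point subspace `C_V(E) = V^E` of a subgroup `E` acting on `V` via `ρ`. -/
def fixedSubmodule {p : ℕ} {G V : Type} [Group G] [AddCommGroup V] [Module (ZMod p) V]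
    (ρ : Representation (ZMod p) G V) (E : Subgroup G) : Submodule (ZMod p) V where
  carrier := {v | ∀ g ∈ E, ρ g v = v}
  add_mem' := fun ha hb g hg => by simp [map_add, ha g hg, hb g hg]
  zero_mem' := fun g hg => by simp
  smul_mem' := fun c v hv g hg => by simp [map_smul, hv g hg]

theorem nilp_aux {p : ℕ} [Fact p.Prime] {V : Type}
    [AddCommGroup V] [Module (ZMod p) V] (f : Module.End (ZMod p) V) (hf : f ^ p = 1) :
    IsNilpotent (f - 1) := by
  refine ⟨p, ?_⟩
  rcases subsingleton_or_nontrivial V with h | h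
  · exact Subsingleton.elim _ _
  · have : CharP (Module.End (ZMod p) V) p :=
      charP_of_injective_algebraMap (algebraMap (ZMod p) (Module.End (ZMod p) V)).injective p
    rw [sub_pow_char_of_commute _ (Commute.one_right f), hf]
    simp

theorem span_aux {p : ℕ} [Fact p.Prime] {G V : Type} [Group G]
    [AddCommGroup V] [Module (ZMod p) V]
    (ρ : Representation (ZMod p) G V) (E : Subgroup G)
    (hEp : ∀ g ∈ E, g ^ p = 1) (hEab : ∀ a ∈ E, ∀ b ∈ E, a * b = b * a)
    (T : Module.End (ZMod p) V)
    (hT : T ∈ Submodule.span (ZMod p) {f | ∃ a ∈ E, f = ρ a - 1}) :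
    IsNilpotent T ∧ ∀ S : Module.End (ZMod p) V, (∀ a ∈ E, Commute S (ρ a)) → Commute S T := by
  have hab : ∀ a ∈ E, ∀ b ∈ E, Commute (ρ a) (ρ b) := by
    intro a ha b hb
    show ρ a * ρ b = ρ b * ρ a
    rw [← map_mul, ← map_mul, hEab a ha b hb]
  induction hT using Submodule.span_induction with
  | mem x h =>
    obtain ⟨a, ha, rfl⟩ := h
    refine ⟨nilp_aux _ ?_, fun S hS => (hS a ha).sub_right (Commute.one_right S)⟩
    rw [← map_pow, hEp a ha, map_one]
  | zero => exact ⟨IsNilpotent.zero, fun S _ => Commute.zero_right S⟩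
  | add x y _ _ hx hy =>
    refine ⟨Commute.isNilpotent_add ?_ hx.1 hy.1, fun S hS => (hx.2 S hS).add_right (hy.2 S hS)⟩
    exact hy.2 x fun a ha => (hx.2 (ρ a) fun b hb => hab a ha b hb).symm
  | smul c x _ hx =>
    exact ⟨hx.1.smul c, fun S hS => (hx.2 S hS).smul_right c⟩

theorem main_aux {p : ℕ} [Fact p.Prime] {G V : Type} [Group G] [Finite G]
    [AddCommGroup V] [Module (ZMod p) V] [Finite V]
    (ρ : Representation (ZMod p) G V) (n : ℕ) :
    ∀ (E : Subgroup G) (_ : Nat.card E = n) (_ : E ≠ ⊥)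
    (_ : ∀ g ∈ E, g ^ p = 1) (_ : ∀ a ∈ E, ∀ b ∈ E, a * b = b * a)
    (_ : Nat.card V ≤ Nat.card E * Nat.card (fixedSubmodule ρ E)),
    ∃ g ∈ E, g ≠ 1 ∧ (ρ g - 1) ^ 2 = 0 := by
  induction n using Nat.strong_induction_on with
  | _ n ih =>
  intro E hn hE hEp hEab hoff
  have hcomm : ∀ a ∈ E, ∀ b ∈ E, ∀ v, ρ a (ρ b v) = ρ b (ρ a v) := by
    intro a ha b hb v
    rw [← Module.End.mul_apply, ← Module.End.mul_apply, ← map_mul, ← map_mul, hEab a ha b hb]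
  by_cases hq : ∀ v, ∀ a ∈ E, ∀ b ∈ E, ρ b (ρ a v - v) = ρ a v - v
  · obtain ⟨g, hg, hg1⟩ : ∃ g, g ∈ E ∧ g ≠ 1 := by
      by_contra! h
      exact hE ((Subgroup.eq_bot_iff_forall E).2 h)
    refine ⟨g, hg, hg1, ?_⟩
    ext v
    have := hq v g hg g hg
    simp only [pow_two, Module.End.mul_apply, LinearMap.sub_apply, Module.End.one_apply,
      LinearMap.zero_apply]
    rw [this, sub_self]
  push Not at hq
  obtain ⟨v, a₀, ha₀, b₀, hb₀, hne⟩ := hq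
  let B : Subgroup G :=
    { carrier := {b | b ∈ E ∧ ∀ c ∈ E, ρ b (ρ c v - v) = ρ c v - v}
      mul_mem' := by
        rintro x y ⟨hx, hx'⟩ ⟨hy, hy'⟩
        refine ⟨E.mul_mem hx hy, fun c hc => ?_⟩
        rw [map_mul, Module.End.mul_apply, hy' c hc, hx' c hc]
      one_mem' := ⟨E.one_mem, fun c _ => by simp⟩
      inv_mem' := by
        rintro x ⟨hx, hx'⟩
        refine ⟨E.inv_mem hx, fun c hc => ?_⟩
        conv_lhs => rw [← hx' c hc]
        rw [← Module.End.mul_apply, ← map_mul]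
        simp }
  have hBE : B ≤ E := fun b hb => hb.1
  have hBlt : B < E := lt_of_le_of_ne hBE fun h => hne ((h ▸ hb₀ : b₀ ∈ B).2 a₀ ha₀)
  let J := Submodule.span (ZMod p) {f : Module.End (ZMod p) V | ∃ a ∈ E, f = ρ a - 1}
  let M : Submodule (ZMod p) V := J.map (LinearMap.applyₗ v)
  let C := fixedSubmodule ρ E
  have hM : ∀ a ∈ E, ρ a v - v ∈ M := fun a ha =>
    ⟨ρ a - 1, Submodule.subset_span ⟨a, ha, rfl⟩, by simp⟩
  have hMB : C ⊔ M ≤ fixedSubmodule ρ B := by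
    refine sup_le (fun x hx g hg => hx g (hBE hg)) ?_
    rw [Submodule.map_le_iff_le_comap]
    refine Submodule.span_le.2 ?_
    rintro _ ⟨a, ha, rfl⟩ g hg
    simpa using hg.2 a ha
  have key : Nat.card (↥E ⧸ B.subgroupOf E) * Nat.card C ≤ Nat.card ↥(C ⊔ M) := by
    rw [← Nat.card_prod]
    refine Nat.card_le_card_of_injective
      (fun x => (⟨x.2.1 + (ρ (x.1.out : G) v - v), Submodule.add_mem_sup x.2.2
        (hM _ x.1.out.2)⟩ : ↥(C ⊔ M))) ?_
    rintro ⟨q, c⟩ ⟨q', c'⟩ h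
    have h : c.1 + (ρ (q.out : G) v - v) = c'.1 + (ρ (q'.out : G) v - v) := congrArg Subtype.val h
    have hqq : q = q' := by
      rw [← q.out_eq', ← q'.out_eq', QuotientGroup.eq, Subgroup.mem_subgroupOf]
      generalize q.out = a at *
      generalize q'.out = b at *
      refine ⟨(a⁻¹ * b).2, fun e he => ?_⟩
      have hw : ρ (b : G) v = ρ (a : G) v + (c - c' : C).1 := by
        rw [Submodule.coe_sub, ← sub_eq_zero, ← sub_eq_zero.2 h.symm]; abel
      generalize c - c' = w at *
      have hd : ρ ((a⁻¹ * b : E) : G) v = v + w.1 := by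
        rw [Subgroup.coe_mul, map_mul, Module.End.mul_apply, hw, map_add,
          w.2 _ (a⁻¹ : E).2, ← Module.End.mul_apply, ← map_mul]
        simp
      rw [map_sub, hcomm _ (a⁻¹ * b : E).2 e he, hd, map_add, w.2 e he]
      abel
    subst hqq
    have : c = c' := Subtype.ext (add_right_cancel h)
    rw [this]
  have hcard : Nat.card E = Nat.card (↥E ⧸ B.subgroupOf E) * Nat.card B := by
    rw [Subgroup.card_eq_card_quotient_mul_card_subgroup (B.subgroupOf E),
      Nat.card_congr (Subgroup.subgroupOfEquivOfLe hBE).toEquiv]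
  have hle : Nat.card V ≤ Nat.card B * Nat.card ↥(C ⊔ M) := by
    refine hoff.trans ?_
    rw [hcard]
    calc _ = Nat.card B * (Nat.card (↥E ⧸ B.subgroupOf E) * Nat.card C) := by ring
      _ ≤ _ := Nat.mul_le_mul_left _ key
  by_cases hB : B = ⊥
  · exfalso
    have hBc : Nat.card B = 1 := by rw [hB]; simp
    rw [hBc, one_mul] at hle
    have htop : v ∈ C ⊔ M := by
      have h1 : ((C ⊔ M : Submodule (ZMod p) V) : Set V) = Set.univ :=
        Set.eq_of_subset_of_ncard_le (Set.subset_univ _)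
          (by rw [Set.ncard_univ]; exact hle) (Set.toFinite _)
      have : v ∈ ((C ⊔ M : Submodule (ZMod p) V) : Set V) := h1 ▸ Set.mem_univ v
      exact this
    obtain ⟨c, hc, m, ⟨T, hT, rfl⟩, hcm⟩ := Submodule.mem_sup.1 htop
    obtain ⟨hTn, hTc⟩ := span_aux ρ E hEp hEab T hT
    have hu : IsUnit (1 - T) := hTn.isUnit_one_sub
    have hfix : ρ a₀ v = v := by
      have hcv : (1 - T) v = c := by
        have : c + T v = v := hcm
        rw [LinearMap.sub_apply, Module.End.one_apply, sub_eq_iff_eq_add]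
        exact this.symm
      have hca : Commute (ρ a₀) T := hTc _ fun b hb => by
        show ρ a₀ * ρ b = ρ b * ρ a₀
        rw [← map_mul, ← map_mul, hEab a₀ ha₀ b hb]
      have hinj := ((Module.End.isUnit_iff _).1 hu).1
      apply hinj
      have h2 : (1 - T) * ρ a₀ = ρ a₀ * (1 - T) := by
        rw [sub_mul, mul_sub, hca.eq, one_mul, mul_one]
      rw [← Module.End.mul_apply, h2, Module.End.mul_apply, hcv, hc a₀ ha₀]
    apply hne
    rw [hfix]; simp
  · have hlt : Nat.card B < n := by
      rw [← hn]
      exact Set.ncard_lt_ncard (SetLike.coe_ssubset_coe.2 hBlt) (Set.toFinite _)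
    obtain ⟨g, hg, h⟩ := ih _ hlt B rfl hB (fun g hg => hEp g (hBE hg))
      (fun a ha b hb => hEab a (hBE ha) b (hBE hb))
      (hle.trans (Nat.mul_le_mul_left _
        (Nat.card_le_card_of_injective _ (Submodule.inclusion_injective hMB))))
    exact ⟨g, hBE hg, h⟩

theorem stmt9 {p : ℕ} [Fact p.Prime] (hp : Odd p) {G V : Type} [Group G] [Finite G]
    [AddCommGroup V] [Module (ZMod p) V] [FiniteDimensional (ZMod p) V]
    (ρ : Representation (ZMod p) G V) (hfaith : Function.Injective ρ)
    (E : Subgroup G) (hE : E ≠ ⊥)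
    (hEp : ∀ g ∈ E, g ^ p = 1) (hEab : ∀ a ∈ E, ∀ b ∈ E, a * b = b * a)
    (hoff : Nat.card V ≤ Nat.card E * Nat.card (fixedSubmodule ρ E)) :
    ∃ g ∈ E, g ≠ 1 ∧ (ρ g - 1) ^ 2 = 0 := by
  have : Finite V := Module.finite_of_finite (ZMod p)
  exact main_aux ρ _ E rfl hE hEp hEab hoff
end

section
/- Let p be an odd prime, G ≠ 1 a finite p-group of nilpotence class at most two, and V a faithful finite-dimensional F_p[G]-module such that every element of order p in Z(G) acts on V with minimal polynomial (X−1)^p. Then V is not an F-module for G: no nonidentity elementary abelian p-subgroup E ≤ G satisfies |E|·|C_V(E)| ≥ |V|. -/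
open Module Polynomial

section Helpers

variable {p : ℕ} [Fact p.Prime] {G V : Type} [Group G] [Finite G]
    [AddCommGroup V] [Module (ZMod p) V] [FiniteDimensional (ZMod p) V]

/-- An invariant nonzero functional vanishing on the fixed points. -/
lemma aux_functional (hG : IsPGroup p G) (ρ : Representation (ZMod p) G V) (E : Subgroup G)
    (hC : fixedSubmodule ρ E ≠ ⊤) :
    ∃ φ : Dual (ZMod p) V, φ ≠ 0 ∧ (∀ c ∈ fixedSubmodule ρ E, φ c = 0) ∧
      ∀ e ∈ E, ∀ v, φ (ρ e v) = φ v := by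
  classical
  set W := (fixedSubmodule ρ E).dualAnnihilator with hW
  have hWmem : ∀ φ : Dual (ZMod p) V, φ ∈ W ↔ ∀ c ∈ fixedSubmodule ρ E, φ c = 0 := by
    intro φ; rw [hW, Submodule.mem_dualAnnihilator]
  letI : MulAction E W :=
    { smul := fun e φ => ⟨φ.1 ∘ₗ ρ (e.1⁻¹), by
        rw [hWmem]
        intro c hc
        have := hc _ (E.inv_mem e.2)
        simp only [LinearMap.comp_apply]
        rw [this]
        exact (hWmem _).1 φ.2 c hc⟩
      one_smul := by
        intro φ
        apply Subtype.ext
        apply LinearMap.ext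
        intro v
        change φ.1 (ρ ((1 : G)⁻¹) v) = φ.1 v
        simp
      mul_smul := by
        intro a b φ
        apply Subtype.ext
        apply LinearMap.ext
        intro v
        change φ.1 (ρ ((a.1 * b.1)⁻¹) v) = φ.1 (ρ b.1⁻¹ (ρ a.1⁻¹ v))
        simp [mul_inv_rev] }
  have hfinD : Finite (Dual (ZMod p) V) := Module.finite_of_finite (ZMod p)
  have hE : IsPGroup p E := hG.to_subgroup E
  have hWbot : W ≠ ⊥ := by
    intro h
    apply hC
    exact Subspace.dualAnnihilator_inj.1 (by rw [← hW, h, Submodule.dualAnnihilator_top])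
  have hdvd : p ∣ Nat.card W := by
    have h1 : Nat.card W = p ^ finrank (ZMod p) W := by
      rw [Module.natCard_eq_pow_finrank (K := ZMod p), Nat.card_zmod]
    rw [h1]
    apply dvd_pow_self
    intro h0
    exact hWbot (Submodule.finrank_eq_zero.1 h0)
  have h0 : (0 : W) ∈ MulAction.fixedPoints E W := by
    intro e
    apply Subtype.ext
    apply LinearMap.ext
    intro v
    rfl
  obtain ⟨φ, hφ, hne⟩ := hE.exists_fixed_point_of_prime_dvd_card_of_fixed_point W hdvd h0
  refine ⟨φ.1, fun h => hne (Subtype.ext h.symm), (hWmem _).1 φ.2, ?_⟩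
  intro e he v
  have := hφ ⟨e⁻¹, E.inv_mem he⟩
  have h2 := LinearMap.congr_fun (congrArg Subtype.val this) v
  change φ.1 (ρ ((e⁻¹)⁻¹) v) = φ.1 v at h2
  simpa using h2

/-- The centralizer in `E` of `[v, E]`. -/
def auxB (ρ : Representation (ZMod p) G V) (E : Subgroup G) (v : V) : Subgroup G where
  carrier := {h | h ∈ E ∧ ∀ a ∈ E, ρ h (ρ a v - v) = ρ a v - v}
  one_mem' := ⟨E.one_mem, by simp⟩
  mul_mem' := by
    rintro x y ⟨hx, hx'⟩ ⟨hy, hy'⟩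
    refine ⟨E.mul_mem hx hy, fun a ha => ?_⟩
    rw [map_mul, Module.End.mul_apply, hy' a ha, hx' a ha]
  inv_mem' := by
    rintro x ⟨hx, hx'⟩
    refine ⟨E.inv_mem hx, fun a ha => ?_⟩
    conv_lhs => rw [← hx' a ha]
    rw [← Module.End.mul_apply, ← map_mul]
    simp

/-- `C_V(E) + [v, E]`. -/
def auxS (ρ : Representation (ZMod p) G V) (E : Subgroup G) (v : V) : Submodule (ZMod p) V :=
  fixedSubmodule ρ E ⊔ Submodule.span (ZMod p) {w | ∃ a ∈ E, w = ρ a v - v}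

lemma aux_card (ρ : Representation (ZMod p) G V) (E : Subgroup G)
    (hab : ∀ a ∈ E, ∀ b ∈ E, a * b = b * a) (v : V) :
    Nat.card E * Nat.card (fixedSubmodule ρ E) ≤
      Nat.card (auxB ρ E v) * Nat.card (auxS ρ E v) := by
  classical
  have hfin : Finite V := Module.finite_of_finite (ZMod p)
  have hBE : auxB ρ E v ≤ E := fun x hx => hx.1
  have hCS : fixedSubmodule ρ E ≤ auxS ρ E v := le_sup_left
  set B' := (auxB ρ E v).subgroupOf E
  set C' := (fixedSubmodule ρ E).submoduleOf (auxS ρ E v)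
  have hB : Nat.card B' = Nat.card (auxB ρ E v) :=
    Nat.card_congr (Subgroup.subgroupOfEquivOfLe hBE).toEquiv
  have hC : Nat.card C' = Nat.card (fixedSubmodule ρ E) :=
    Nat.card_congr (Submodule.submoduleOfEquivOfLe hCS).toEquiv
  have hE : Nat.card E = Nat.card (E ⧸ B') * Nat.card B' := Subgroup.card_eq_card_quotient_mul_card_subgroup B'
  have hS : Nat.card (auxS ρ E v) = Nat.card C' * Nat.card (auxS ρ E v ⧸ C') :=
    Submodule.card_eq_card_quotient_mul_card C'
  have hmem : ∀ a ∈ E, ρ a v - v ∈ auxS ρ E v := fun a ha =>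
    (le_sup_right : _ ≤ auxS ρ E v) (Submodule.subset_span ⟨a, ha, rfl⟩)
  let f : E ⧸ B' → auxS ρ E v ⧸ C' := fun q =>
    Submodule.Quotient.mk ⟨ρ q.out.1 v - v, hmem _ q.out.2⟩
  have hf : Function.Injective f := by
    intro q r hqr
    have h1 := (Submodule.Quotient.eq C').1 hqr
    have h2 : (ρ q.out.1 v - v) - (ρ r.out.1 v - v) ∈ fixedSubmodule ρ E := h1
    rw [sub_sub_sub_cancel_right] at h2
    have key : (r.out : E)⁻¹ * q.out ∈ B' := by
      rw [Subgroup.mem_subgroupOf]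
      refine ⟨((r.out : E)⁻¹ * q.out).2, fun a ha => ?_⟩
      set x := q.out.1 with hx
      set y := r.out.1 with hy
      have hxE : x ∈ E := q.out.2
      have hyE : y ∈ E := r.out.2
      change ρ (y⁻¹ * x) (ρ a v - v) = ρ a v - v
      have h3 := h2 a ha
      have h4 := h2 (y⁻¹ * a) (E.mul_mem (E.inv_mem hyE) ha)
      have h5 := h2 (y⁻¹) (E.inv_mem hyE)
      simp only [map_sub, ← Module.End.mul_apply, ← map_mul] at h3 h4 h5 ⊢
      have e1 : y⁻¹ * a * x = y⁻¹ * x * a := by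
        rw [mul_assoc, hab a ha x hxE, mul_assoc]
      have e2 : y⁻¹ * a * y = a := by
        rw [mul_assoc, hab a ha y hyE, inv_mul_cancel_left]
      rw [e1, e2] at h4
      simp only [inv_mul_cancel, map_one, Module.End.one_apply] at h5
      rw [sub_eq_sub_iff_sub_eq_sub, h4, h5]
    have := QuotientGroup.eq.2 key
    simpa using this.symm
  have hfq : Finite (auxS ρ E v ⧸ C') :=
    Finite.of_surjective _ (Submodule.Quotient.mk_surjective C')
  have hle := Nat.card_le_card_of_injective f hf
  rw [hE, hS, hB, hC]
  calc _ = Nat.card (E ⧸ B') * (Nat.card (auxB ρ E v) * Nat.card (fixedSubmodule ρ E)) := by ring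
    _ ≤ Nat.card (auxS ρ E v ⧸ C') * (Nat.card (auxB ρ E v) * Nat.card (fixedSubmodule ρ E)) :=
      Nat.mul_le_mul_right _ hle
    _ = _ := by ring

lemma aux_quad (hG : IsPGroup p G) (ρ : Representation (ZMod p) G V)
    (hfaith : Function.Injective ρ) (n : ℕ) : ∀ E : Subgroup G, Nat.card E = n → E ≠ ⊥ →
      (∀ a ∈ E, ∀ b ∈ E, a * b = b * a) →
      Nat.card V ≤ Nat.card E * Nat.card (fixedSubmodule ρ E) →
      ∃ x ∈ E, x ≠ 1 ∧ (ρ x - 1) ^ 2 = 0 := by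
  have hfin : Finite V := Module.finite_of_finite (ZMod p)
  induction n using Nat.strong_induction_on with
  | _ n ih =>
    intro E hn hE hab hoff
    have hnt : ∀ v, auxB ρ E v ≠ ⊥ := by
      intro v hv
      have h1 := aux_card ρ E hab v
      rw [hv, Subgroup.card_bot, one_mul] at h1
      have hS : auxS ρ E v = ⊤ := by
        by_contra hne
        have hlt : (auxS ρ E v : Set V).ncard < (Set.univ : Set V).ncard :=
          Set.ncard_lt_ncard (by
            rw [Set.ssubset_univ_iff]
            intro h
            exact hne (SetLike.coe_injective h)) (Set.toFinite _)
        rw [Set.ncard_univ] at hlt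
        have : Nat.card (auxS ρ E v) = (auxS ρ E v : Set V).ncard := rfl
        omega
      have hCtop : fixedSubmodule ρ E ≠ ⊤ := by
        intro h
        apply hE
        rw [Subgroup.eq_bot_iff_forall]
        intro x hx
        apply hfaith
        apply LinearMap.ext
        intro w
        have : w ∈ fixedSubmodule ρ E := h ▸ Submodule.mem_top
        rw [this x hx]; simp
      obtain ⟨φ, hφ, hφC, hφE⟩ := aux_functional hG ρ E hCtop
      apply hφ
      have : auxS ρ E v ≤ LinearMap.ker φ := by
        apply sup_le
        · intro c hc; exact hφC c hc
        · rw [Submodule.span_le]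
          rintro w ⟨a, ha, rfl⟩
          simp [hφE a ha]
      rw [hS, top_le_iff] at this
      exact LinearMap.ker_eq_top.1 this
    by_cases hall : ∀ v, auxB ρ E v = E
    · obtain ⟨x, hx, hx1⟩ := (Subgroup.ne_bot_iff_exists_ne_one.1 hE |>.imp fun a h => h) |> fun ⟨a, h⟩ => (⟨a.1, a.2, fun h' => h (Subtype.ext h')⟩ : ∃ x, x ∈ E ∧ x ≠ 1)
      refine ⟨x, hx, hx1, ?_⟩
      apply LinearMap.ext
      intro v
      have : x ∈ auxB ρ E v := (hall v).symm ▸ hx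
      have h2 := this.2 x hx
      simp only [sq, Module.End.mul_apply, LinearMap.sub_apply, Module.End.one_apply,
        LinearMap.zero_apply]
      rw [h2, sub_self]
    · push Not at hall
      obtain ⟨v, hv⟩ := hall
      have hBE : auxB ρ E v ≤ E := fun x hx => hx.1
      have hlt : Nat.card (auxB ρ E v) < n := by
        rw [← hn]
        exact Set.ncard_lt_ncard (lt_of_le_of_ne hBE hv : (auxB ρ E v) < E) (Set.toFinite _)
      have hSB : auxS ρ E v ≤ fixedSubmodule ρ (auxB ρ E v) := by
        apply sup_le
        · intro c hc g hg; exact hc g (hBE hg)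
        · rw [Submodule.span_le]
          rintro w ⟨a, ha, rfl⟩ g hg
          exact hg.2 a ha
      have hc : Nat.card (auxS ρ E v) ≤ Nat.card (fixedSubmodule ρ (auxB ρ E v)) :=
        Set.ncard_le_ncard (fun x hx => hSB hx) (Set.toFinite _)
      obtain ⟨x, hx, h⟩ := ih _ hlt (auxB ρ E v) rfl (hnt v)
        (fun a ha b hb => hab a (hBE ha) b (hBE hb))
        (hoff.trans ((aux_card ρ E hab v).trans (Nat.mul_le_mul_left _ hc)))
      exact ⟨x, hBE hx, h⟩

end Helpers

lemma aux_ring {R : Type*} [CommRing R] (P Z Y : R) (hY : Y * Z = 1) (h0 : (P - 1) ^ 2 = 0)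
    (h1 : (Z * P - 1) ^ 2 = 0) (h2 : (Z * Z * P - 1) ^ 2 = 0) : 2 * (Z - 1) ^ 2 = 0 := by
  have hPQ : P * (2 - P) = 1 := by linear_combination -h0
  have a0 : P + (2 - P) = 2 := by ring
  have a1 : Z ^ 2 * P - 2 * Z + (2 - P) = 0 := by
    linear_combination (2 - P) * h1 + (-Z^2*P + 2 * Z) * hPQ
  have a2 : Z ^ 4 * P - 2 * Z ^ 2 + (2 - P) = 0 := by
    linear_combination (2 - P) * h2 + (-Z^4*P + 2 * Z^2) * hPQ
  have b1 : (Z - 1) * ((Z + 1) * P - 2) = 0 := by linear_combination a1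
  have b2 : Z * ((Z - 1) * (Z * (Z + 1) * P - 2)) = 0 := by linear_combination a2 - a1
  have b3 : (Z - 1) * (Z * (Z + 1) * P - 2) = 0 := by
    linear_combination Y * b2 - ((Z - 1) * (Z * (Z + 1) * P - 2)) * hY
  linear_combination b3 - Z * b1

lemma aux_ring' {k A : Type*} [CommRing k] [Ring A] [Algebra k A] (P Z Y : A) (hY : Y * Z = 1)
    (hY' : Z * Y = 1)
    (hc : P * Z = Z * P) (hc' : P * Y = Y * P) (h0 : (P - 1) ^ 2 = 0)
    (h1 : (Z * P - 1) ^ 2 = 0) (h2 : (Z * Z * P - 1) ^ 2 = 0) : 2 * (Z - 1) ^ 2 = 0 := by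
  letI : CommRing (Algebra.adjoin k ({P, Z, Y} : Set A)) :=
    Algebra.adjoinCommRingOfComm k (by
      intro a ha b hb
      simp only [Set.mem_insert_iff, Set.mem_singleton_iff] at ha hb
      rcases ha with rfl | rfl | rfl <;> rcases hb with rfl | rfl | rfl <;> simp [*])
  have := aux_ring (R := Algebra.adjoin k ({P, Z, Y} : Set A))
    ⟨P, Algebra.subset_adjoin (by simp)⟩ ⟨Z, Algebra.subset_adjoin (by simp)⟩
    ⟨Y, Algebra.subset_adjoin (by simp)⟩ (Subtype.ext hY) (Subtype.ext h0) (Subtype.ext h1)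
    (Subtype.ext h2)
  exact congrArg Subtype.val this

theorem stmt10 {p : ℕ} [Fact p.Prime] (hp : Odd p) {G V : Type} [Group G] [Finite G]
    [Nontrivial G] (hG : IsPGroup p G)
    (hclass2 : ∀ a b : G, a * b * a⁻¹ * b⁻¹ ∈ Subgroup.center G)
    [AddCommGroup V] [Module (ZMod p) V] [FiniteDimensional (ZMod p) V]
    (ρ : Representation (ZMod p) G V) (hfaith : Function.Injective ρ)
    (hPS : ∀ z ∈ Subgroup.center G, z ≠ 1 → z ^ p = 1 →
      minpoly (ZMod p) (ρ z) = (X - 1) ^ p) :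
    ¬ ∃ E : Subgroup G, E ≠ ⊥ ∧ (∀ g ∈ E, g ^ p = 1) ∧
      (∀ a ∈ E, ∀ b ∈ E, a * b = b * a) ∧
      Nat.card V ≤ Nat.card E * Nat.card (fixedSubmodule ρ E) := by
  rintro ⟨E, hE, hexp, hab, hoff⟩
  obtain ⟨x, hxE, hx1, hxq⟩ := aux_quad hG ρ hfaith _ E rfl hE hab hoff
  have hp3 : 2 < p := by
    have := (Fact.out : p.Prime).two_le
    rcases hp with ⟨k, hk⟩
    omega
  have hnoquad : ∀ z ∈ Subgroup.center G, z ≠ 1 → z ^ p = 1 → (ρ z - 1) ^ 2 ≠ 0 := by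
    intro z hz hz1 hzp h
    have hd : minpoly (ZMod p) (ρ z) ∣ (X - 1) ^ 2 := by
      apply minpoly.dvd
      simpa using h
    rw [hPS z hz hz1 hzp] at hd
    have hm : (X - 1 : (ZMod p)[X]).Monic := by simpa using monic_X_sub_C (1 : ZMod p)
    have hdeg : (X - 1 : (ZMod p)[X]).natDegree = 1 := by
      simpa using natDegree_X_sub_C (1 : ZMod p)
    have := natDegree_le_of_dvd hd (hm.pow 2).ne_zero
    rw [hm.natDegree_pow, hm.natDegree_pow, hdeg] at this
    omega
  have hxp := hexp x hxE
  have hxc : x ∉ Subgroup.center G := fun h => hnoquad x h hx1 hxp hxq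
  rw [Subgroup.mem_center_iff] at hxc
  push Not at hxc
  obtain ⟨g, hg⟩ := hxc
  set c := g * x * g⁻¹ * x⁻¹ with hcdef
  have hcc : c ∈ Subgroup.center G := hclass2 g x
  have hcomm : ∀ h, h * c = c * h := Subgroup.mem_center_iff.1 hcc
  have hconj : g * x * g⁻¹ = c * x := by rw [hcdef]; group
  clear_value c
  have hc1 : c ≠ 1 := by
    intro h
    rw [h, one_mul] at hconj
    exact hg (mul_inv_eq_iff_eq_mul.1 hconj)
  have hcp : c ^ p = 1 := by
    have h1 : (g * x * g⁻¹) ^ p = 1 := by rw [conj_pow, hxp]; simp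
    rw [hconj, (show Commute c x from (hcomm x).symm).mul_pow, hxp, mul_one] at h1
    exact h1
  have hconj2 : g * (c * x) * g⁻¹ = c * c * x := by
    calc g * (c * x) * g⁻¹ = (g * c) * x * g⁻¹ := by simp only [mul_assoc]
      _ = c * (g * x * g⁻¹) := by rw [hcomm g]; simp only [mul_assoc]
      _ = c * c * x := by rw [hconj, mul_assoc]
  have hq : ∀ y : G, (ρ y - 1) ^ 2 = 0 → (ρ (g * y * g⁻¹) - 1) ^ 2 = 0 := by
    intro y hy
    have e1 : ρ g * ρ g⁻¹ = 1 := by rw [← map_mul]; simp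
    have e2 : ρ g⁻¹ * ρ g = 1 := by rw [← map_mul]; simp
    have e3 : ρ (g * y * g⁻¹) - 1 = ρ g * (ρ y - 1) * ρ g⁻¹ := by
      rw [map_mul, map_mul, mul_sub, sub_mul, mul_one, e1]
    rw [e3, sq]
    calc _ = ρ g * (ρ y - 1) * (ρ g⁻¹ * ρ g) * (ρ y - 1) * ρ g⁻¹ := by simp only [mul_assoc]
      _ = ρ g * (ρ y - 1) ^ 2 * ρ g⁻¹ := by rw [e2, sq]; simp only [mul_assoc, one_mul]
      _ = 0 := by rw [hy]; simp
  have q1 := hq x hxq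
  rw [hconj] at q1
  have q2 := hq _ q1
  rw [hconj2] at q2
  simp only [map_mul] at q1 q2
  have hfinal := aux_ring' (k := ZMod p) (ρ x) (ρ c) (ρ c⁻¹) (by rw [← map_mul]; simp)
    (by rw [← map_mul]; simp) (by rw [← map_mul, ← map_mul, hcomm x])
    (by
      rw [← map_mul, ← map_mul]
      congr 1
      exact (show Commute x c from hcomm x).inv_right) hxq q1 q2
  apply hnoquad c hcc hc1 hcp
  have h2 : (2 : ZMod p) ≠ 0 := by
    intro h
    have h' : ((2 : ℕ) : ZMod p) = 0 := by exact_mod_cast h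
    rw [ZMod.natCast_eq_zero_iff] at h'
    exact absurd (Nat.le_of_dvd (by norm_num) h') (by omega)
  have h3 : (2 : ZMod p) • (ρ c - 1) ^ 2 = 0 := by
    rw [two_smul, ← two_mul]; exact hfinal
  exact (smul_eq_zero.1 h3).resolve_left h2
end
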